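/- Let T be a plane rooted tree and write Q(T) = Σ_{i=0}^{N} a_i q^i with N = deg Q(T). Then the coefficient sequence (a_0, a_1, …, a_N) is unimodal: there exists k with a_0 ≤ a_1 ≤ ⋯ ≤ a_{k−1} ≤ a_k ≥ a_{k+1} ≥ ⋯ ≥ a_N. -/

import Mathlib

/-- A plane rooted tree: a root with an ordered list of plane rooted subtrees. -/
inductive PTree : Type where
  | node : List PTree → PTree

namespace PTree

mutual
/-- Number of edges of a plane rooted tree. -/
def edges : PTree → ℕ
  | .node l => edgesL l
def edgesL : List PTree → ℕ
  | [] => 0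
  | t :: ts => (edges t + 1) + edgesL ts
end

mutual
/-- Number of vertices of a plane rooted tree. -/
def vertices : PTree → ℕ
  | .node l => 1 + verticesL l
def verticesL : List PTree → ℕ
  | [] => 0
  | t :: ts => vertices t + verticesL ts
end

mutual
/-- `plucks T` is the list, indexed by the leaves `v` of `T`, of the pairs
`(r(T,v), T - v)`, where `r(T,v)` is the number of vertices strictly to the
right of the path from `v` to the root, and `T - v` is `T` with the leaf `v`
(and its edge) deleted. -/
def plucks : PTree → List (ℕ × PTree)
  | .node l => (plucksL l).map (fun p => (p.1, PTree.node p.2))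
def plucksL : List PTree → List (ℕ × List PTree)
  | [] => []
  | t :: ts =>
      (match t with
       | .node [] => [(verticesL ts, ts)]
       | .node (s :: ss) =>
          (plucks (.node (s :: ss))).map (fun p => (p.1 + verticesL ts, p.2 :: ts)))
      ++ (plucksL ts).map (fun p => (p.1, t :: p.2))
end

/-- The plucking polynomial, computed with a fuel parameter (the fuel is the
number of edges; each plucking removes exactly one edge). -/
noncomputable def Qfuel : ℕ → PTree → Polynomial ℤ
  | 0, _ => 1
  | (k+1), t =>
      if edges t = 0 then 1
      else ((plucks t).map (fun p => Polynomial.X ^ p.1 * Qfuel k p.2)).sum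

/-- The plucking polynomial `Q(T)` of a plane rooted tree: `Q(T) = 1` if `T` has
no edges, and otherwise `Q(T) = Σ_v q^{r(T,v)} Q(T - v)`, summed over the leaves of `T`. -/
noncomputable def Q (t : PTree) : Polynomial ℤ := Qfuel (edges t) t

end PTree

/-- The `q`-analogue `[a]_q = 1 + q + ⋯ + q^{a-1}`. -/
noncomputable def qInt (a : ℕ) : Polynomial ℤ := (Finset.range a).sum (fun i => Polynomial.X ^ i)

/-- The `q`-factorial `[a]_q! = [1]_q [2]_q ⋯ [a]_q`. -/
noncomputable def qFact : ℕ → Polynomial ℤ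
  | 0 => 1
  | (a+1) => qFact a * qInt (a+1)

/-- The `q`-multinomial coefficient
`(a₁+⋯+a_k choose a₁,…,a_k)_q = [a₁+⋯+a_k]_q! / ([a₁]_q! ⋯ [a_k]_q!)`
(the division, by a monic polynomial, is exact). -/
noncomputable def qMultinomial (l : List ℕ) : Polynomial ℤ :=
  qFact l.sum /ₘ (l.map qFact).prod

/-- The Gaussian binomial coefficient `(a+c choose a)_q`. -/
noncomputable def qBinom (a c : ℕ) : Polynomial ℤ := qMultinomial [a, c]

section StringCone

open Polynomial

/-- The cone of polynomials that are nonnegative combinations of the strings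
`q^k + ⋯ + q^{d-k}` centred at `d / 2`. -/
noncomputable def stringCone (d : ℕ) : AddSubmonoid ℤ[X] :=
  AddSubmonoid.closure {p | ∃ k n, 2 * k + n = d ∧ p = X ^ k * qInt (n + 1)}

theorem qInt_succ (n : ℕ) : qInt (n + 1) = qInt n + X ^ n := Finset.sum_range_succ _ _

theorem qInt_add (m n : ℕ) : qInt (m + n) = qInt m + X ^ m * qInt n := by
  simp only [qInt, Finset.sum_range_add, Finset.mul_sum, pow_add]

theorem coeff_qInt (n i : ℕ) : (qInt n).coeff i = if i < n then 1 else 0 := by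
  simp [qInt, coeff_X_pow]

theorem qInt_succ_mul_qInt_succ (m n : ℕ) :
    qInt (m + 1) * qInt (n + 1) = qInt (m + n + 1) + X * (qInt m * qInt n) := by
  have h₁ : qInt (m + 1) = 1 + X * qInt m := by
    rw [add_comm, qInt_add]; simp [qInt]
  have h₂ : qInt (m + n + 1) = qInt (n + 1) + X ^ (n + 1) * qInt m := by
    rw [← qInt_add]; congr 1; omega
  rw [h₂, h₁, qInt_succ n]
  ring

theorem X_pow_mul_qInt_mem_stringCone {k n d : ℕ} (h : 2 * k + n = d) :
    X ^ k * qInt (n + 1) ∈ stringCone d :=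
  AddSubmonoid.subset_closure ⟨k, n, h, rfl⟩

theorem X_mul_mem_stringCone {d : ℕ} {p : ℤ[X]} (hp : p ∈ stringCone d) :
    X * p ∈ stringCone (d + 2) := by
  induction hp using AddSubmonoid.closure_induction with
  | mem p hp =>
    obtain ⟨k, n, h, rfl⟩ := hp
    rw [← mul_assoc, ← pow_succ']
    exact X_pow_mul_qInt_mem_stringCone (by omega)
  | zero => simp
  | add p q _ _ hp hq => rw [mul_add]; exact add_mem hp hq

theorem X_pow_mul_mem_stringCone {d : ℕ} {p : ℤ[X]} (hp : p ∈ stringCone d) (k : ℕ) :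
    X ^ k * p ∈ stringCone (2 * k + d) := by
  induction k with
  | zero => simpa using hp
  | succ k ih =>
    rw [pow_succ', mul_assoc, show 2 * (k + 1) + d = 2 * k + d + 2 by ring]
    exact X_mul_mem_stringCone ih

theorem qInt_mul_qInt_mem_stringCone (m n : ℕ) :
    qInt (m + 1) * qInt (n + 1) ∈ stringCone (m + n) := by
  induction m generalizing n with
  | zero => simpa [qInt] using X_pow_mul_qInt_mem_stringCone (show 2 * 0 + n = 0 + n by simp)
  | succ m ih =>
    cases n with
    | zero =>
      simpa [qInt] using X_pow_mul_qInt_mem_stringCone (show 2 * 0 + (m + 1) = m + 1 + 0 by simp)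
    | succ n =>
      rw [qInt_succ_mul_qInt_succ]
      refine add_mem ?_ ?_
      · simpa using X_pow_mul_qInt_mem_stringCone
          (show 2 * 0 + (m + 1 + (n + 1)) = m + 1 + (n + 1) by simp)
      · rw [show m + 1 + (n + 1) = m + n + 2 by ring]
        exact X_mul_mem_stringCone (ih n)

theorem mul_mem_stringCone {d e : ℕ} {p q : ℤ[X]} (hp : p ∈ stringCone d)
    (hq : q ∈ stringCone e) : p * q ∈ stringCone (d + e) := by
  induction hp using AddSubmonoid.closure_induction with
  | mem p hp =>
    obtain ⟨k, m, rfl, rfl⟩ := hp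
    induction hq using AddSubmonoid.closure_induction with
    | mem q hq =>
      obtain ⟨l, n, rfl, rfl⟩ := hq
      rw [show 2 * k + m + (2 * l + n) = 2 * (k + l) + (m + n) by ring]
      convert X_pow_mul_mem_stringCone (qInt_mul_qInt_mem_stringCone m n) (k + l) using 1
      ring
    | zero => simp
    | add p q _ _ hp hq => rw [mul_add]; exact add_mem hp hq
  | zero => simp
  | add p q _ _ hp hq => rw [add_mul]; exact add_mem hp hq

theorem one_mem_stringCone : (1 : ℤ[X]) ∈ stringCone 0 := by
  simpa [qInt] using X_pow_mul_qInt_mem_stringCone (show 2 * 0 + 0 = 0 from rfl)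

theorem C_mul_qInt_mem_stringCone {c : ℤ} (hc : 0 ≤ c) (d : ℕ) :
    C c * qInt (d + 1) ∈ stringCone d := by
  lift c to ℕ using hc
  have h := nsmul_mem (X_pow_mul_qInt_mem_stringCone (show 2 * 0 + d = d by simp)) c
  simpa [nsmul_eq_mul] using h

theorem mem_stringCone_of_coeff {d : ℕ} {p : ℤ[X]} (h₀ : 0 ≤ p.coeff 0)
    (hsymm : ∀ i j, i + j = d → p.coeff i = p.coeff j) (hdeg : ∀ i, d < i → p.coeff i = 0)
    (hmono : ∀ i, 2 * i < d → p.coeff i ≤ p.coeff (i + 1)) : p ∈ stringCone d := by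
  induction d using Nat.twoStepInduction generalizing p with
  | zero =>
    convert C_mul_qInt_mem_stringCone h₀ 0 using 1
    ext i
    rw [coeff_C_mul, coeff_qInt]
    rcases i with _ | i
    · simp
    · simp [hdeg (i + 1) (by omega)]
  | one =>
    convert C_mul_qInt_mem_stringCone h₀ 1 using 1
    ext i
    rw [coeff_C_mul, coeff_qInt]
    rcases i with _ | _ | i
    · simp
    · simp [hsymm 1 0 rfl]
    · simp [hdeg (i + 2) (by omega)]
  | more d ih _ =>
    set r : ℤ[X] := p - C (p.coeff 0) * qInt (d + 2 + 1) with hr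
    have hcoeff (i : ℕ) :
        r.divX.coeff i = p.coeff (i + 1) - if i < d + 2 then p.coeff 0 else 0 := by
      simp [hr, coeff_divX, coeff_qInt, Nat.lt_succ_iff]
    have hdecomp : p = C (p.coeff 0) * qInt (d + 2 + 1) + X * r.divX := by
      have h := r.X_mul_divX_add
      have h0 : r.coeff 0 = 0 := by simp [hr, coeff_qInt]
      rw [h0] at h
      simp only [map_zero, add_zero] at h
      rw [h, hr]
      ring
    rw [hdecomp]
    refine add_mem (C_mul_qInt_mem_stringCone h₀ _) (X_mul_mem_stringCone (ih ?_ ?_ ?_ ?_))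
    · have := hmono 0 (by omega)
      rw [hcoeff]
      simpa using this
    · intro i j hij
      rw [hcoeff, hcoeff, if_pos (by omega), if_pos (by omega), hsymm (i + 1) (j + 1) (by omega)]
    · intro i hi
      rw [hcoeff]
      split_ifs with h
      · rw [hsymm (i + 1) 0 (by omega), sub_self]
      · rw [hdeg _ (by omega), sub_self]
    · intro i hi
      rw [hcoeff, hcoeff, if_pos (by omega), if_pos (by omega)]
      have := hmono (i + 1) (by omega)
      omega

theorem coeff_X_pow_mul_qInt (k n i : ℕ) :
    (X ^ k * qInt n).coeff i = if k ≤ i ∧ i < k + n then 1 else 0 := by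
  rw [coeff_X_pow_mul', coeff_qInt]
  split_ifs <;> first | rfl | omega

theorem coeff_le_coeff_succ_of_mem_stringCone {d : ℕ} {p : ℤ[X]} (hp : p ∈ stringCone d)
    {i : ℕ} (hi : 2 * i < d) : p.coeff i ≤ p.coeff (i + 1) := by
  induction hp using AddSubmonoid.closure_induction with
  | mem p hp =>
    obtain ⟨k, n, h, rfl⟩ := hp
    rw [coeff_X_pow_mul_qInt, coeff_X_pow_mul_qInt]
    split_ifs <;> omega
  | zero => simp
  | add p q _ _ hp hq => rw [coeff_add, coeff_add]; exact add_le_add hp hq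

theorem coeff_succ_le_coeff_of_mem_stringCone {d : ℕ} {p : ℤ[X]} (hp : p ∈ stringCone d)
    {i : ℕ} (hi : d ≤ 2 * i + 1) : p.coeff (i + 1) ≤ p.coeff i := by
  induction hp using AddSubmonoid.closure_induction with
  | mem p hp =>
    obtain ⟨k, n, h, rfl⟩ := hp
    rw [coeff_X_pow_mul_qInt, coeff_X_pow_mul_qInt]
    split_ifs <;> omega
  | zero => simp
  | add p q _ _ hp hq => rw [coeff_add, coeff_add]; exact add_le_add hp hq

theorem exists_peak_of_mem_stringCone {d : ℕ} {p : ℤ[X]} (hp : p ∈ stringCone d) (N : ℕ) :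
    ∃ k ≤ N, (∀ i j, i ≤ j → j ≤ k → p.coeff i ≤ p.coeff j) ∧
      ∀ i j, k ≤ i → i ≤ j → j ≤ N → p.coeff j ≤ p.coeff i := by
  refine ⟨min (d / 2) N, min_le_right _ _, fun i j hij hj => ?_, fun i j hi hij hj => ?_⟩
  · induction j, hij using Nat.le_induction with
    | base => exact le_rfl
    | succ j hij ih =>
      exact (ih (by omega)).trans (coeff_le_coeff_succ_of_mem_stringCone hp (by omega))
  · induction j, hij using Nat.le_induction with
    | base => exact le_rfl
    | succ j hij ih =>
      exact (coeff_succ_le_coeff_of_mem_stringCone hp (by omega)).trans (ih (by omega))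

end StringCone

section BoxSum

/-- The exponents of the monomials of degree `c` in the variables `x₀, …, x_a`, that is, the
partitions with at most `c` parts, all of them at most `a`. -/
noncomputable def box (a c : ℕ) : Finset (ℕ →₀ ℕ) :=
  (Finset.range (a + 1)).finsuppAntidiag c

/-- The size `∑ i * m i` of the partition in which `i` occurs `m i` times. -/
noncomputable def size : (ℕ →₀ ℕ) →+ ℕ := Finsupp.weight id

/-- The generating polynomial of the partitions in a `c × a` box. -/
noncomputable def boxSum (a c : ℕ) : Polynomial ℤ :=
  ∑ m ∈ box a c, Polynomial.X ^ size m

theorem size_single (i k : ℕ) : size (Finsupp.single i k) = k * i := by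
  simp [size, Finsupp.weight_single]

theorem mem_box {a c : ℕ} {m : ℕ →₀ ℕ} :
    m ∈ box a c ↔ m.degree = c ∧ ∀ i, m i ≠ 0 → i ≤ a := by
  rw [box, Finset.mem_finsuppAntidiag]
  have hs : m.support ⊆ Finset.range (a + 1) ↔ ∀ i, m i ≠ 0 → i ≤ a := by
    simp [Finset.subset_iff]
  rw [hs]
  refine and_congr_left fun h => ?_
  rw [Finsupp.degree_apply, Finset.sum_subset (hs.2 h)]
  simp

theorem box_zero_right (a : ℕ) : box a 0 = {0} := by
  ext m
  simp only [mem_box, Finsupp.degree_eq_zero_iff, Finset.mem_singleton]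
  constructor
  · exact And.left
  · rintro rfl
    simp

theorem boxSum_zero_right (a : ℕ) : boxSum a 0 = 1 := by
  simp [boxSum, box_zero_right]

theorem box_zero_left (c : ℕ) : box 0 c = {Finsupp.single 0 c} := by
  ext m
  rw [mem_box, Finset.mem_singleton]
  constructor
  · rintro ⟨rfl, h⟩
    have hm : m = Finsupp.single 0 (m 0) := by
      ext i
      rcases i with _ | i
      · simp
      · have : m (i + 1) = 0 := by
          by_contra h'
          exact absurd (h _ h') (by omega)
        simp [this]
    rw [hm]
    simp
  · rintro rfl
    refine ⟨by simp, fun i hi => ?_⟩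
    by_contra h
    exact hi (Finsupp.single_eq_of_ne (by omega))

theorem boxSum_zero_left (c : ℕ) : boxSum 0 c = 1 := by
  simp [boxSum, box_zero_left, size_single]

theorem boxSum_succ_succ (a c : ℕ) :
    boxSum (a + 1) (c + 1) =
      Polynomial.X ^ (a + 1) * boxSum (a + 1) c + boxSum a (c + 1) := by
  have hbox : box (a + 1) (c + 1) =
      ((box (a + 1) c).map (addRightEmbedding (Finsupp.single (a + 1) 1))) ∪
        box a (c + 1) := by
    ext m
    simp only [Finset.mem_union, Finset.mem_map, addRightEmbedding_apply, mem_box]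
    constructor
    · rintro ⟨hd, hm⟩
      by_cases h : m (a + 1) = 0
      · refine Or.inr ⟨hd, fun i hi => ?_⟩
        have := hm i hi
        have : i ≠ a + 1 := by rintro rfl; exact hi h
        omega
      · have hsub : m - Finsupp.single (a + 1) 1 + Finsupp.single (a + 1) 1 = m :=
          tsub_add_cancel_of_le (Finsupp.single_le_iff.2 (Nat.one_le_iff_ne_zero.2 h))
        refine Or.inl ⟨m - Finsupp.single (a + 1) 1, ⟨?_, fun i hi => hm i ?_⟩, hsub⟩
        · have := congrArg Finsupp.degree hsub
          rw [map_add, Finsupp.degree_single] at this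
          omega
        · rw [Finsupp.tsub_apply] at hi
          omega
    · rintro (⟨m, ⟨rfl, hm⟩, rfl⟩ | ⟨hd, hm⟩)
      · refine ⟨by simp, fun i hi => ?_⟩
        by_contra h
        have : m i = 0 := by
          by_contra h'
          exact h (hm i h')
        rw [Finsupp.add_apply, this, Finsupp.single_eq_of_ne (by omega)] at hi
        exact hi rfl
      · exact ⟨hd, fun i hi => (hm i hi).trans (Nat.le_succ a)⟩
  have hdisj : Disjoint ((box (a + 1) c).map (addRightEmbedding (Finsupp.single (a + 1) 1)))
      (box a (c + 1)) := by
    rw [Finset.disjoint_left]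
    simp only [Finset.mem_map, addRightEmbedding_apply, mem_box]
    rintro _ ⟨m, -, rfl⟩ ⟨-, h⟩
    have := h (a + 1) (by simp)
    omega
  rw [boxSum, hbox, Finset.sum_union hdisj, Finset.sum_map, boxSum, boxSum, Finset.mul_sum]
  simp [size_single, pow_add, mul_comm]

theorem coeff_boxSum (a c j : ℕ) :
    (boxSum a c).coeff j = ((box a c).filter (fun m => size m = j)).card := by
  simp [boxSum, Polynomial.coeff_X_pow, eq_comm]

/-- Complementation of a partition in a box: the part `i` is replaced by `a - i`. -/
noncomputable def reflect (a : ℕ) (m : ℕ →₀ ℕ) : ℕ →₀ ℕ := m.mapDomain (a - ·)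

theorem reflect_mem_box {a c : ℕ} {m : ℕ →₀ ℕ} (hm : m ∈ box a c) : reflect a m ∈ box a c := by
  rw [mem_box] at hm ⊢
  refine ⟨by rw [reflect, Finsupp.degree_mapDomain, hm.1], fun i hi => ?_⟩
  have := Finsupp.mapDomain_support (Finsupp.mem_support_iff.2 hi)
  simp only [Finset.mem_image] at this
  obtain ⟨k, -, rfl⟩ := this
  exact Nat.sub_le _ _

theorem reflect_reflect {a c : ℕ} {m : ℕ →₀ ℕ} (hm : m ∈ box a c) :
    reflect a (reflect a m) = m := by
  rw [reflect, reflect, ← Finsupp.mapDomain_comp]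
  conv_rhs => rw [← Finsupp.mapDomain_id (v := m)]
  refine Finsupp.mapDomain_congr fun i hi => ?_
  have := (mem_box.1 hm).2 i (Finsupp.mem_support_iff.1 hi)
  simp only [Function.comp, id]
  omega

theorem size_add_size_reflect {a c : ℕ} {m : ℕ →₀ ℕ} (hm : m ∈ box a c) :
    size m + size (reflect a m) = a * c := by
  rw [mem_box] at hm
  have h : size (reflect a m) = m.sum fun i k => k * (a - i) := by
    rw [size, Finsupp.weight_apply, reflect, Finsupp.sum_mapDomain_index] <;>
      simp [add_mul]
  rw [h, size, Finsupp.weight_apply, ← hm.1, Finsupp.degree_apply, Finsupp.sum, Finsupp.sum,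
    ← Finset.sum_add_distrib, Finset.mul_sum]
  refine Finset.sum_congr rfl fun i hi => ?_
  have := hm.2 i (Finsupp.mem_support_iff.1 hi)
  rw [id, smul_eq_mul, ← mul_add, Nat.add_sub_cancel' this, mul_comm]

theorem coeff_boxSum_symm {a c i j : ℕ} (h : i + j = a * c) :
    (boxSum a c).coeff i = (boxSum a c).coeff j := by
  rw [coeff_boxSum, coeff_boxSum]
  congr 1
  refine Finset.card_nbij' (reflect a) (reflect a) ?_ ?_ ?_ ?_
  · intro m hm
    simp only [Finset.coe_filter, Set.mem_ofPred_eq] at hm ⊢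
    have := size_add_size_reflect hm.1
    exact ⟨reflect_mem_box hm.1, by omega⟩
  · intro m hm
    simp only [Finset.coe_filter, Set.mem_ofPred_eq] at hm ⊢
    have := size_add_size_reflect hm.1
    exact ⟨reflect_mem_box hm.1, by omega⟩
  · intro m hm
    simp only [Finset.coe_filter, Set.mem_ofPred_eq] at hm
    exact reflect_reflect hm.1
  · intro m hm
    simp only [Finset.coe_filter, Set.mem_ofPred_eq] at hm
    exact reflect_reflect hm.1

theorem coeff_boxSum_eq_zero {a c i : ℕ} (h : a * c < i) : (boxSum a c).coeff i = 0 := by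
  rw [coeff_boxSum, Nat.cast_eq_zero, Finset.card_eq_zero, Finset.filter_eq_empty_iff]
  intro m hm
  have := size_add_size_reflect hm
  omega

end BoxSum

section Sl2

open MvPolynomial

/-- In a module over `sl₂`, a vector of positive weight on which `D` acts nilpotently is zero as
soon as it is killed by `U`, where `D` raises weights by `2` and `[D, U] = H`. -/
theorem eq_zero_of_sl2 {M : Type*} [AddCommGroup M] [Module ℚ M] {U D H : M →ₗ[ℚ] M}
    (hDU : ∀ x, D (U x) - U (D x) = H x) (hHD : ∀ x, H (D x) - D (H x) = (2 : ℚ) • D x)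
    {v : M} {μ : ℚ} (hμ : 0 < μ) (hH : H v = μ • v) (hU : U v = 0) {k : ℕ}
    (hD : (D ^ k) v = 0) : v = 0 := by
  have hHD' (s : ℕ) : H ((D ^ s) v) = (μ + 2 * s) • (D ^ s) v := by
    induction s with
    | zero => simpa using hH
    | succ s ih =>
      have := hHD ((D ^ s) v)
      rw [ih, map_smul, sub_eq_iff_eq_add] at this
      rw [pow_succ', Module.End.mul_apply, this, ← add_smul]
      congr 1
      push_cast
      ring
  have hUD (s : ℕ) : U ((D ^ (s + 1)) v) = -((s + 1) * (μ + s)) • (D ^ s) v := by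
    induction s with
    | zero =>
      have := hDU v
      rw [hU, hH, map_zero, zero_sub, neg_eq_iff_eq_neg] at this
      simp [this]
    | succ s ih =>
      have := hDU ((D ^ (s + 1)) v)
      rw [ih, hHD', map_smul, ← Module.End.mul_apply D, ← pow_succ', sub_eq_iff_eq_add,
        ← sub_eq_iff_eq_add', ← sub_smul] at this
      rw [pow_succ' D (s + 1), Module.End.mul_apply, ← this]
      congr 1
      push_cast
      ring
  induction k with
  | zero => simpa using hD
  | succ k ih =>
    refine ih ?_
    have := hUD k
    rw [hD, map_zero, eq_comm, smul_eq_zero] at this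
    refine this.resolve_left (neg_ne_zero.2 ?_)
    positivity

/-- The operator `x_i ↦ (a - i) x_{i+1}`. -/
noncomputable def raise (a : ℕ) : Derivation ℚ (MvPolynomial ℕ ℚ) (MvPolynomial ℕ ℚ) :=
  mkDerivation ℚ fun i => C ((a : ℚ) - i) * X (i + 1)

/-- The operator `x_i ↦ i x_{i-1}`. -/
noncomputable def lower : Derivation ℚ (MvPolynomial ℕ ℚ) (MvPolynomial ℕ ℚ) :=
  mkDerivation ℚ fun i => C (i : ℚ) * X (i - 1)

/-- The operator `x_i ↦ (a - 2 i) x_i`. -/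
noncomputable def cartan (a : ℕ) : Derivation ℚ (MvPolynomial ℕ ℚ) (MvPolynomial ℕ ℚ) :=
  mkDerivation ℚ fun i => C ((a : ℚ) - 2 * i) * X i

theorem lie_lower_raise (a : ℕ) : ⁅lower, raise a⁆ = cartan a := by
  refine derivation_ext fun i => ?_
  rw [Derivation.commutator_apply]
  have h₂ : (C 2 : MvPolynomial ℕ ℚ) = 2 := map_ofNat C 2
  rcases i with _ | i
  · simp [lower, raise, cartan, Derivation.leibniz, mkDerivation_X]
  · simp [lower, raise, cartan, Derivation.leibniz, mkDerivation_X, h₂]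
    ring

theorem lie_cartan_lower (a : ℕ) : ⁅cartan a, lower⁆ = (2 : ℚ) • lower := by
  refine derivation_ext fun i => ?_
  rw [Derivation.commutator_apply]
  have h₂ : (C 2 : MvPolynomial ℕ ℚ) = 2 := map_ofNat C 2
  rcases i with _ | i
  · simp [lower, cartan, Derivation.leibniz, mkDerivation_X]
  · simp [lower, cartan, Derivation.leibniz, mkDerivation_X, smul_eq_C_mul]
    rw [h₂]
    ring

theorem mkDerivation_C_mul_X_monomial (f : ℕ → ℚ) (g : ℕ → ℕ) (m : ℕ →₀ ℕ) :
    mkDerivation ℚ (fun i => C (f i) * X (g i)) (monomial m 1) =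
      ∑ i ∈ m.support, (m i * f i) •
        monomial (m - Finsupp.single i 1 + Finsupp.single (g i) 1) (1 : ℚ) := by
  rw [mkDerivation_monomial, one_smul, Finsupp.sum]
  refine Finset.sum_congr rfl fun i _ => ?_
  rw [smul_eq_mul, C_mul_X_eq_monomial, monomial_mul, smul_monomial, smul_eq_mul, mul_one]

theorem sub_single_add_single {m : ℕ →₀ ℕ} {i : ℕ} (hi : i ∈ m.support) :
    m - Finsupp.single i 1 + Finsupp.single i 1 = m :=
  tsub_add_cancel_of_le
    (Finsupp.single_le_iff.2 (Nat.one_le_iff_ne_zero.2 (Finsupp.mem_support_iff.1 hi)))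

theorem cartan_monomial {a c : ℕ} {m : ℕ →₀ ℕ} (hm : m ∈ box a c) :
    cartan a (monomial m 1) = ((a * c : ℚ) - 2 * size m) • monomial m 1 := by
  rw [cartan, mkDerivation_C_mul_X_monomial, ← (mem_box.1 hm).1, size, Finsupp.weight_apply,
    Finsupp.degree_apply, Finsupp.sum]
  push_cast
  rw [Finset.mul_sum, Finset.mul_sum, ← Finset.sum_sub_distrib, Finset.sum_smul]
  refine Finset.sum_congr rfl fun i hi => ?_
  rw [sub_single_add_single hi]
  congr 1
  simp
  ring

theorem sub_single_add_single_mem_box {a c i j : ℕ} {m : ℕ →₀ ℕ} (hm : m ∈ box a c)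
    (hi : i ∈ m.support) (hj : j ≤ a) :
    m - Finsupp.single i 1 + Finsupp.single j 1 ∈ box a c := by
  rw [mem_box] at hm ⊢
  have hd := congrArg Finsupp.degree (sub_single_add_single hi)
  rw [map_add, Finsupp.degree_single] at hd
  refine ⟨by rw [map_add, Finsupp.degree_single, hd, hm.1], fun k hk => ?_⟩
  by_cases hkj : k = j
  · exact hkj ▸ hj
  · refine hm.2 k fun h => hk ?_
    rw [Finsupp.add_apply, Finsupp.tsub_apply, h, Finsupp.single_eq_of_ne hkj]
    simp

theorem size_sub_single_add_single {i : ℕ} (j : ℕ) {m : ℕ →₀ ℕ} (hi : i ∈ m.support) :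
    size (m - Finsupp.single i 1 + Finsupp.single j 1) + i = size m + j := by
  have h := congrArg size (sub_single_add_single hi)
  rw [map_add, size_single, one_mul] at h
  rw [map_add, size_single, one_mul]
  omega

theorem raise_monomial_mem_span {a c : ℕ} {m : ℕ →₀ ℕ} (hm : m ∈ box a c) :
    raise a (monomial m 1) ∈ Submodule.span ℚ ((fun n => monomial n (1 : ℚ)) ''
      {n | n ∈ box a c ∧ size n = size m + 1}) := by
  rw [raise, mkDerivation_C_mul_X_monomial]
  refine Submodule.sum_mem _ fun i hi => ?_
  have hia := (mem_box.1 hm).2 i (Finsupp.mem_support_iff.1 hi)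
  rcases hia.eq_or_lt with rfl | hia
  · simp
  · refine Submodule.smul_mem _ _ (Submodule.subset_span ⟨_, ⟨?_, ?_⟩, rfl⟩)
    · exact sub_single_add_single_mem_box hm hi hia
    · have := size_sub_single_add_single (i + 1) hi
      omega

theorem lower_pow_monomial_eq_zero {k : ℕ} {m : ℕ →₀ ℕ} (hm : size m < k) :
    ((lower : MvPolynomial ℕ ℚ →ₗ[ℚ] MvPolynomial ℕ ℚ) ^ k) (monomial m 1) = 0 := by
  induction k generalizing m with
  | zero => omega
  | succ k ih =>
    rw [pow_succ, Module.End.mul_apply, Derivation.coeFn_coe, lower,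
      mkDerivation_C_mul_X_monomial, map_sum]
    refine Finset.sum_eq_zero fun i hi => ?_
    rcases i with _ | i
    · simp
    · have := size_sub_single_add_single (i + 1 - 1) hi
      rw [map_smul, ← lower, ih (by omega), smul_zero]

theorem coeff_boxSum_le_coeff_succ {a c j : ℕ} (hj : 2 * j < a * c) :
    (boxSum a c).coeff j ≤ (boxSum a c).coeff (j + 1) := by
  rw [coeff_boxSum, coeff_boxSum, Nat.cast_le]
  set s := (box a c).filter fun m => size m = j with hs
  set t := (box a c).filter fun m => size m = j + 1 with ht
  let v : s → MvPolynomial ℕ ℚ := fun m => monomial m.1 1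
  have hv : LinearIndependent ℚ v :=
    (basisMonomials ℕ ℚ).linearIndependent.comp _ Subtype.val_injective
  let U : MvPolynomial ℕ ℚ →ₗ[ℚ] MvPolynomial ℕ ℚ := raise a
  let D : MvPolynomial ℕ ℚ →ₗ[ℚ] MvPolynomial ℕ ℚ := lower
  let H : MvPolynomial ℕ ℚ →ₗ[ℚ] MvPolynomial ℕ ℚ := cartan a
  have hH : Submodule.span ℚ (Set.range v) ≤
      LinearMap.ker (H - ((a * c : ℚ) - 2 * j) • LinearMap.id) := by
    rw [Submodule.span_le]
    rintro _ ⟨⟨m, hm⟩, rfl⟩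
    rw [hs, Finset.mem_filter] at hm
    have := cartan_monomial hm.1
    rw [hm.2] at this
    simp [H, v, this]
  have hD : Submodule.span ℚ (Set.range v) ≤ LinearMap.ker (D ^ (j + 1)) := by
    rw [Submodule.span_le]
    rintro _ ⟨⟨m, hm⟩, rfl⟩
    rw [hs, Finset.mem_filter] at hm
    exact lower_pow_monomial_eq_zero (hm.2 ▸ Nat.lt_succ_self _)
  have hker : Disjoint (Submodule.span ℚ (Set.range v)) (LinearMap.ker U) := by
    rw [Submodule.disjoint_def]
    intro p hp hU
    refine eq_zero_of_sl2 (U := U) (D := D) (H := H) (μ := (a * c : ℚ) - 2 * j)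
      (fun x => ?_) (fun x => ?_) ?_ ?_ hU (hD hp)
    · exact (Derivation.commutator_apply ..).symm.trans (DFunLike.congr_fun (lie_lower_raise a) x)
    · exact (Derivation.commutator_apply ..).symm.trans (DFunLike.congr_fun (lie_cartan_lower a) x)
    · have : (2 * j : ℚ) < a * c := by exact_mod_cast hj
      linarith
    · simpa [sub_eq_zero] using hH hp
  have hle := linearIndependent_le_span' _ (hv.map hker)
    (t.image fun n => monomial n (1 : ℚ) : Finset (MvPolynomial ℕ ℚ)) ?_
  · rw [Cardinal.mk_fintype, Nat.cast_le, Fintype.card_coe] at hle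
    refine hle.trans ?_
    simpa using Finset.card_image_le
  · rintro _ ⟨⟨m, hm⟩, rfl⟩
    rw [hs, Finset.mem_filter] at hm
    simpa [ht, hm.2, U, v] using raise_monomial_mem_span hm.1

end Sl2

theorem boxSum_mem_stringCone (a c : ℕ) : boxSum a c ∈ stringCone (a * c) := by
  refine mem_stringCone_of_coeff ?_ (fun _ _ => coeff_boxSum_symm)
    (fun _ => coeff_boxSum_eq_zero) (fun _ => coeff_boxSum_le_coeff_succ)
  rw [coeff_boxSum]
  exact Nat.cast_nonneg _

namespace PTree

open Polynomial

mutual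
theorem vertices_eq : ∀ t : PTree, vertices t = edges t + 1
  | .node l => by rw [vertices, edges, verticesL_eq l, add_comm]
theorem verticesL_eq : ∀ l : List PTree, verticesL l = edgesL l
  | [] => rfl
  | t :: ts => by rw [verticesL, edgesL, vertices_eq t, verticesL_eq ts]
end

mutual
theorem edges_of_mem_plucks : ∀ (t : PTree), ∀ p ∈ plucks t, edges p.2 + 1 = edges t
  | .node l => by
    intro p hp
    rw [plucks, List.mem_map] at hp
    obtain ⟨p, hp, rfl⟩ := hp
    rw [edges, edges, edgesL_of_mem_plucksL l p hp]
theorem edgesL_of_mem_plucksL : ∀ (l : List PTree), ∀ p ∈ plucksL l, edgesL p.2 + 1 = edgesL l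
  | [] => by simp [plucksL]
  | .node [] :: ts => by
    intro p hp
    simp only [plucksL, List.singleton_append, List.mem_cons, List.mem_map] at hp
    rcases hp with rfl | ⟨p, hp, rfl⟩
    · simp [edgesL, edges, add_comm]
    · rw [edgesL, edgesL, ← edgesL_of_mem_plucksL ts p hp]
      ring
  | .node (s :: ss) :: ts => by
    intro p hp
    simp only [plucksL, List.mem_append, List.mem_map] at hp
    rcases hp with ⟨p, hp, rfl⟩ | ⟨p, hp, rfl⟩
    · rw [edgesL, edgesL, ← edges_of_mem_plucks (.node (s :: ss)) p hp]
      ring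
    · rw [edgesL, edgesL, ← edgesL_of_mem_plucksL ts p hp]
      ring
end

theorem Q_node_nil : Q (.node []) = 1 := rfl

theorem Q_node_cons (t : PTree) (ts : List PTree) :
    Q (.node (t :: ts)) = ((plucks (.node (t :: ts))).map fun p => X ^ p.1 * Q p.2).sum := by
  have h : edges (.node (t :: ts)) = edges t + edgesL ts + 1 := by
    rw [edges, edgesL]
    ring
  rw [Q, h, Qfuel, if_neg (by omega)]
  congr 1
  refine List.map_congr_left fun p hp => ?_
  have := edges_of_mem_plucks _ p hp
  rw [Q, show edges p.2 = edges t + edgesL ts by omega]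

/-- The `q`-binomial formula for the plucking polynomial of a wedge of two trees. -/
theorem Q_node_cons_eq_boxSum_mul (t : PTree) (ts : List PTree) :
    Q (.node (t :: ts)) = boxSum (edgesL ts) (edges t + 1) * (Q t * Q (.node ts)) := by
  induction hk : edges t + edgesL ts using Nat.strong_induction_on generalizing t ts with
  | _ k ih =>
  subst hk
  have hleft : Q (.node (t :: ts)) =
      X ^ edgesL ts * boxSum (edgesL ts) (edges t) * (Q t * Q (.node ts)) +
        ((plucksL ts).map fun p => X ^ p.1 * Q (.node (t :: p.2))).sum := by
    rcases t with ⟨_ | ⟨s, ss⟩⟩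
    · rw [Q_node_cons, plucks, plucksL]
      simp [Q_node_nil, edges, edgesL, boxSum_zero_right, verticesL_eq, Function.comp_def]
    · rw [Q_node_cons, plucks, plucksL, List.map_map, List.map_append, List.sum_append,
        List.map_map, List.map_map]
      congr 1
      rw [Q_node_cons s ss, ← mul_assoc, ← List.sum_map_mul_left, ← List.sum_map_mul_right]
      refine congrArg List.sum (List.map_congr_left fun p hp => ?_)
      have he := edges_of_mem_plucks _ p hp
      simp only [Function.comp_apply]
      rw [ih _ (by omega) p.2 ts rfl, he, verticesL_eq]
      ring
  have hright : ((plucksL ts).map fun p => X ^ p.1 * Q (.node (t :: p.2))).sum =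
      (boxSum (edgesL ts) (edges t + 1) - X ^ edgesL ts * boxSum (edgesL ts) (edges t)) *
        (Q t * Q (.node ts)) := by
    rcases ts with _ | ⟨s, ss⟩
    · simp [plucksL, edgesL, boxSum_zero_left]
    · obtain ⟨n, hn⟩ : ∃ n, edgesL (s :: ss) = n + 1 := ⟨edges s + edgesL ss, by rw [edgesL]; ring⟩
      rw [Q_node_cons s ss, plucks, hn, boxSum_succ_succ, add_sub_cancel_left, ← mul_assoc,
        ← List.sum_map_mul_left, List.map_map]
      refine congrArg List.sum (List.map_congr_left fun p hp => ?_)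
      have he := edgesL_of_mem_plucksL _ p hp
      have hp2 : edgesL p.2 = n := by omega
      rw [Function.comp_apply, ih _ (by omega) t p.2 rfl, hp2]
      ring
  rw [hleft, hright]
  ring

mutual
theorem exists_Q_mem_stringCone : ∀ t : PTree, ∃ d, Q t ∈ stringCone d
  | .node l => exists_Q_node_mem_stringCone l
theorem exists_Q_node_mem_stringCone : ∀ l : List PTree, ∃ d, Q (.node l) ∈ stringCone d
  | [] => ⟨0, one_mem_stringCone⟩
  | t :: ts => by
    obtain ⟨d, hd⟩ := exists_Q_mem_stringCone t
    obtain ⟨e, he⟩ := exists_Q_node_mem_stringCone ts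
    rw [Q_node_cons_eq_boxSum_mul]
    exact ⟨_, mul_mem_stringCone (boxSum_mem_stringCone _ _) (mul_mem_stringCone hd he)⟩
end

end PTree

/-- **Unimodality.** Writing `Q(T) = Σ_{i=0}^{N} aᵢ qⁱ` with `N = deg Q(T)`, the
coefficient sequence `(a₀, a₁, …, a_N)` is unimodal: there is `k` with
`a₀ ≤ a₁ ≤ ⋯ ≤ a_k ≥ a_{k+1} ≥ ⋯ ≥ a_N`. -/
theorem plucking_unimodal (t : PTree) (N : ℕ) (hN : N = (PTree.Q t).natDegree) :
    ∃ k ≤ N,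
      (∀ i j, i ≤ j → j ≤ k → (PTree.Q t).coeff i ≤ (PTree.Q t).coeff j) ∧
      (∀ i j, k ≤ i → i ≤ j → j ≤ N → (PTree.Q t).coeff j ≤ (PTree.Q t).coeff i) := by
  obtain ⟨d, hd⟩ := PTree.exists_Q_mem_stringCone t
  exact exists_peak_of_mem_stringCone hd N
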